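/- Strong Gibbs decomposition over the excursion interval: let X be a λ-area-tilted random walk bridge on I with floor 0 and zero boundary values, R > 0, and t ∈ I. Define σ the last time ≤ t and τ the first time ≥ t at which X < (R/2)H_λ, and J := ⟦σ,τ⟧. Then for any bounded measurable F, E[F(X|_J, σ, τ) | 𝓕_{σ,τ}] = E^{λ; X(σ), X(τ)}_{J; (R/2)H_λ}[F(X, σ, τ)], where the inner expectation is over a λ-tilted bridge on J with boundary values X(σ), X(τ) and floor (R/2)H_λ applied only in the interior of J. -/

import Mathlib

open MeasureTheory Real
open scoped ENNReal

noncomputable section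

/-- The full trajectory over `⟦0, n+1⟧` of a bridge with boundary values `u, v`
and interior values `q`. -/
def pathOf (u v : ℝ) (n : ℕ) (q : Fin n → ℝ) : ℕ → ℝ :=
  fun t => if h : 1 ≤ t ∧ t ≤ n then q ⟨t - 1, by omega⟩ else if t = 0 then u else v

/-- Unnormalized density of a random walk bridge on `⟦0, n+1⟧` from `u` to `v`,
with increment Hamiltonian `H`: the product of `exp(-H(increment))` over all steps. -/
def bridgeDensity (H : ℝ → ℝ) (u v : ℝ) (n : ℕ) (q : Fin n → ℝ) : ℝ :=
  ∏ j ∈ Finset.range (n + 1),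
    Real.exp (-(H (pathOf u v n q (j + 1) - pathOf u v n q j)))

/-- The (unnormalized) law of the interior points of a random walk bridge. -/
def bridgeMeasure (H : ℝ → ℝ) (u v : ℝ) (n : ℕ) : Measure (Fin n → ℝ) :=
  volume.withDensity fun q => ENNReal.ofReal (bridgeDensity H u v n q)

open scoped Classical in
/-- The (unnormalized) law of a random walk bridge on `⟦0, n+1⟧` from `u` to `v`
constrained to stay above the floor in the interior, with area tilt
`exp(-c · Σ_j (X(j) - floor(j)))`. -/
def tiltedMeasure (H : ℝ → ℝ) (u v : ℝ) (n : ℕ) (c : ℝ) (floor : ℕ → ℝ) :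
    Measure (Fin n → ℝ) :=
  volume.withDensity fun q =>
    ENNReal.ofReal (bridgeDensity H u v n q
      * Real.exp (-(c * ∑ j ∈ Finset.range (n + 1), (pathOf u v n q j - floor j)))
      * if ∀ t, 1 ≤ t → t ≤ n → floor t ≤ pathOf u v n q t then 1 else 0)

/-- Probability of an event under the normalization of a finite measure. -/
def probOf {α : Type*} [MeasurableSpace α] (μ : Measure α) (E : Set α) : ℝ≥0∞ :=
  μ E / μ Set.univ

/-- The normalized (probability) version of a measure. -/
def normalizeMeasure {α : Type*} [MeasurableSpace α] (μ : Measure α) : Measure α :=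
  (μ Set.univ)⁻¹ • μ

/-- Fluctuation scale `H_λ = λ^{-1/3} N^{1/3}`. -/
def Hlam (lam N : ℝ) : ℝ := lam ^ (-(1 : ℝ) / 3) * N ^ ((1 : ℝ) / 3)

/-- Assumptions on the random walk Hamiltonian: convexity (log-concavity of the
increment density), zero mean, positive finite variance, and finite exponential
moments near zero. -/
structure RWAssumptions (H : ℝ → ℝ) : Prop where
  convex : ConvexOn ℝ Set.univ H
  integrable_exp : Integrable fun x : ℝ => Real.exp (-(H x))
  norm_pos : 0 < ∫ x : ℝ, Real.exp (-(H x))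
  mean_zero : (∫ x : ℝ, x * Real.exp (-(H x))) = 0
  integrable_sq : Integrable fun x : ℝ => x ^ 2 * Real.exp (-(H x))
  var_pos : 0 < ∫ x : ℝ, x ^ 2 * Real.exp (-(H x))
  mgf : ∃ t₀ > 0, ∀ t : ℝ, |t| ≤ t₀ →
    Integrable fun x : ℝ => Real.exp (t * x) * Real.exp (-(H x))

end

noncomputable section

open scoped Classical

/-- The last time `s ≤ t` at which the path is below `h` (it equals `0` if there
is none). -/
def sigmaTime (u v : ℝ) (n : ℕ) (h : ℝ) (t : ℕ) (q : Fin n → ℝ) : ℕ :=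
  Nat.findGreatest (fun s => pathOf u v n q s < h) t

/-- The first time `s ≥ t` at which the path is below `h` (the infimum of the
set of such times). -/
def tauTime (u v : ℝ) (n : ℕ) (h : ℝ) (t : ℕ) (q : Fin n → ℝ) : ℕ :=
  sInf {s | t ≤ s ∧ pathOf u v n q s < h}

/-- Restriction of a trajectory to the window `⟦ℓ, r⟧` (set to `0` outside). -/
def restrictPath (X : ℕ → ℝ) (l r : ℕ) : ℕ → ℝ :=
  fun s => if l ≤ s ∧ s ≤ r then X s else 0

end

open scoped Classical in
/-- The density of `tiltedMeasure` with respect to Lebesgue measure. -/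
noncomputable def tiltedDensity (H : ℝ → ℝ) (u v : ℝ) (n : ℕ) (c : ℝ) (floor : ℕ → ℝ)
    (q : Fin n → ℝ) : ℝ :=
  bridgeDensity H u v n q
    * Real.exp (-(c * ∑ j ∈ Finset.range (n + 1), (pathOf u v n q j - floor j)))
    * if ∀ t, 1 ≤ t → t ≤ n → floor t ≤ pathOf u v n q t then 1 else 0

lemma tiltedMeasure_eq_withDensity (H : ℝ → ℝ) (u v : ℝ) (n : ℕ) (c : ℝ) (floor : ℕ → ℝ) :
    tiltedMeasure H u v n c floor =
      volume.withDensity fun q => ENNReal.ofReal (tiltedDensity H u v n c floor q) := rfl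

lemma tiltedDensity_nonneg (H : ℝ → ℝ) (u v : ℝ) (n : ℕ) (c : ℝ) (floor : ℕ → ℝ)
    (q : Fin n → ℝ) : 0 ≤ tiltedDensity H u v n c floor q := by
  unfold tiltedDensity bridgeDensity
  split_ifs <;> positivity

lemma pathOf_zero (u v : ℝ) (n : ℕ) (q : Fin n → ℝ) : pathOf u v n q 0 = u := by
  simp [pathOf]

lemma pathOf_of_lt (u v : ℝ) {n : ℕ} (q : Fin n → ℝ) {s : ℕ} (hs : n < s) :
    pathOf u v n q s = v := by
  simp [pathOf, show ¬ s ≤ n by omega, show s ≠ 0 by omega]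

lemma pathOf_add_one (u v : ℝ) {n : ℕ} (q : Fin n → ℝ) {i : ℕ} (hi : i < n) :
    pathOf u v n q (i + 1) = q ⟨i, hi⟩ := by
  simp [pathOf, show i + 1 ≤ n by omega]

lemma measurable_pathOf (n s : ℕ) :
    Measurable fun p : ℝ × ℝ × (Fin n → ℝ) => pathOf p.1 p.2.1 n p.2.2 s := by
  unfold pathOf
  split_ifs <;> fun_prop

lemma measurable_tiltedDensity {H : ℝ → ℝ} (hH : Measurable H) (n : ℕ) (c : ℝ)
    (floor : ℕ → ℝ) :
    Measurable fun p : ℝ × ℝ × (Fin n → ℝ) =>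
      tiltedDensity H p.1 p.2.1 n c floor p.2.2 := by
  have hp := measurable_pathOf n
  unfold tiltedDensity bridgeDensity
  refine Measurable.mul (by fun_prop) (Measurable.ite ?_ measurable_const measurable_const)
  simp only [Set.ofPred_forall]
  exact .iInter fun s => .iInter fun _ => .iInter fun _ =>
    measurableSet_le measurable_const (hp s)

lemma normalizeMeasure_univ_le_one {α : Type*} [MeasurableSpace α] (μ : Measure α) :
    normalizeMeasure μ Set.univ ≤ 1 :=
  ENNReal.inv_mul_le_one _

instance {α : Type*} [MeasurableSpace α] (μ : Measure α) :
    IsFiniteMeasure (normalizeMeasure μ) :=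
  ⟨(normalizeMeasure_univ_le_one μ).trans_lt ENNReal.one_lt_top⟩

/-- Integrating `f` against a density `g(a) k(a, b)` is unchanged when the second variable is
resampled from the normalization of `k(a, ·)`. -/
lemma integral_mul_eq_integral_mul_normalizeMeasure {α β : Type*} [MeasurableSpace α]
    [MeasurableSpace β] (ν : Measure α) (ρ : Measure β) [SFinite ν] [SFinite ρ]
    {g : α → ℝ} {k f : α × β → ℝ} (hk0 : ∀ p, 0 ≤ k p)
    (hk : Measurable k) (hf : Measurable f) {C : ℝ} (hC : ∀ p, |f p| ≤ C)
    (hint : Integrable (fun p : α × β => g p.1 * k p) (ν.prod ρ)) :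
    ∫ p, g p.1 * k p * f p ∂(ν.prod ρ) =
      ∫ p, g p.1 * k p *
        (∫ b, f (p.1, b) ∂(normalizeMeasure
          (ρ.withDensity fun b => ENNReal.ofReal (k (p.1, b))))) ∂(ν.prod ρ) := by
  have hCn : ∀ p, ‖f p‖ ≤ C := hC
  set G : α → ℝ := fun a => ∫ b, f (a, b) ∂(normalizeMeasure
    (ρ.withDensity fun b => ENNReal.ofReal (k (a, b)))) with hG
  have hGeq : ∀ a, G a = ((∫⁻ b, ENNReal.ofReal (k (a, b)) ∂ρ)⁻¹).toReal *
      ∫ b, k (a, b) * f (a, b) ∂ρ := by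
    intro a
    have hka : Measurable fun b => k (a, b) := hk.comp measurable_prodMk_left
    simp only [hG, normalizeMeasure]
    rw [integral_smul_measure, withDensity_apply _ MeasurableSet.univ, Measure.restrict_univ,
      integral_withDensity_eq_integral_toReal_smul hka.ennreal_ofReal (by simp)]
    simp [ENNReal.toReal_ofReal (hk0 _)]
  have hGm : Measurable G := by
    rw [funext hGeq]
    refine Measurable.mul ?_ ?_
    · exact (Measurable.lintegral_prod_right' (f := fun p : α × β => ENNReal.ofReal (k p))
        hk.ennreal_ofReal).inv.ennreal_toReal
    · exact (StronglyMeasurable.integral_prod_right' (f := fun p : α × β => k p * f p)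
        (hk.mul hf).stronglyMeasurable).measurable
  have hGC : ∀ a, ‖G a‖ ≤ |C| := by
    intro a
    refine (norm_integral_le_of_norm_le_const (C := |C|)
      (.of_forall fun b => (hCn _).trans (le_abs_self C))).trans ?_
    refine mul_le_of_le_one_right (abs_nonneg C) ?_
    exact ENNReal.toReal_le_of_le_ofReal zero_le_one
      ((normalizeMeasure_univ_le_one _).trans_eq ENNReal.ofReal_one.symm)
  have hL : Integrable (fun p : α × β => g p.1 * k p * f p) (ν.prod ρ) :=
    hint.mul_bdd hf.aestronglyMeasurable (.of_forall hCn)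
  have hR : Integrable (fun p : α × β => g p.1 * k p * G p.1) (ν.prod ρ) :=
    hint.mul_bdd (hGm.comp measurable_fst).aestronglyMeasurable
      (.of_forall fun p => hGC p.1)
  rw [integral_prod _ hL, integral_prod _ hR]
  refine integral_congr_ae ?_
  filter_upwards [hint.prod_right_ae] with a ha
  simp only [mul_assoc]
  rw [integral_const_mul, integral_const_mul]
  rcases eq_or_ne (g a) 0 with h0 | h0
  · simp [h0]
  have hka : Integrable (fun b => k (a, b)) ρ := by
    simpa [h0] using ha.const_mul (g a)⁻¹
  congr 1
  rw [integral_mul_const, hGeq, ← ofReal_integral_eq_lintegral_ofReal hka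
    (.of_forall fun b => hk0 _)]
  have hZ0 : 0 ≤ ∫ b, k (a, b) ∂ρ := integral_nonneg fun b => hk0 _
  rw [ENNReal.toReal_inv, ENNReal.toReal_ofReal hZ0]
  rcases eq_or_ne (∫ b, k (a, b) ∂ρ) 0 with hZ | hZ
  · rw [hZ, zero_mul]
    have hk_ae := (integral_eq_zero_iff_of_nonneg (fun b => hk0 (a, b)) hka).1 hZ
    refine integral_eq_zero_of_ae ?_
    filter_upwards [hk_ae] with b hb
    simp only [Pi.zero_apply] at hb ⊢
    rw [hb, zero_mul]
  · rw [mul_inv_cancel_left₀ hZ]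

/-- Splitting the coordinates of `Fin n → ℝ` into those outside and those inside an open
window `(l, r)` of path times. -/
lemma exists_measurableEquiv_window {n l r : ℕ} (hr : r ≤ n + 1) (hlr : l < r) :
    ∃ e : (Fin n → ℝ) ≃ᵐ
        ({i : Fin n // i.1 + 1 ≤ l ∨ r ≤ i.1 + 1} → ℝ) × (Fin (r - l - 1) → ℝ),
      MeasurePreserving e volume (volume.prod volume) ∧
      (∀ q i, (e q).1 i = q i.1) ∧
      ∀ q j, (e q).2 j = q ⟨l + j.1, by omega⟩ := by
  let σ : {i : Fin n // ¬ (i.1 + 1 ≤ l ∨ r ≤ i.1 + 1)} ≃ Fin (r - l - 1) :=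
    { toFun := fun i => ⟨i.1.1 - l, by have := i.2; omega⟩
      invFun := fun j => ⟨⟨l + j.1, by omega⟩, by simp only; omega⟩
      left_inv := fun i => by
        have := i.2
        ext
        simp only
        omega
      right_inv := fun j => by ext; simp }
  refine ⟨(MeasurableEquiv.piEquivPiSubtypeProd (fun _ : Fin n => ℝ)
      (fun i => i.1 + 1 ≤ l ∨ r ≤ i.1 + 1)).trans
      (MeasurableEquiv.prodCongr (MeasurableEquiv.refl _)
        (MeasurableEquiv.arrowCongr' σ (MeasurableEquiv.refl ℝ))), ?_, ?_, ?_⟩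
  · exact ((MeasurePreserving.id volume).prod (volume_preserving_arrowCongr' σ
      (MeasurableEquiv.refl ℝ) (.id volume))).comp
        (volume_preserving_piEquivPiSubtypeProd (fun _ : Fin n => ℝ)
          (fun i => i.1 + 1 ≤ l ∨ r ≤ i.1 + 1))
  · intro q i; rfl
  · intro q j; rfl

lemma pathOf_congr_outside {n l r : ℕ} (u v : ℝ) {q q' : Fin n → ℝ}
    (h : ∀ i : Fin n, (i.1 + 1 ≤ l ∨ r ≤ i.1 + 1) → q i = q' i) (s : ℕ)
    (hs : s ≤ l ∨ r ≤ s) : pathOf u v n q s = pathOf u v n q' s := by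
  rcases s with _ | i
  · simp [pathOf_zero]
  · by_cases hi : i < n
    · rw [pathOf_add_one _ _ _ hi, pathOf_add_one _ _ _ hi]
      exact h ⟨i, hi⟩ hs
    · rw [pathOf_of_lt _ _ _ (by omega), pathOf_of_lt _ _ _ (by omega)]

/-- A path restricted to a window is the path with the window's end values as boundary. -/
lemma pathOf_window {n l r : ℕ} (u v : ℝ) (hr : r ≤ n + 1) (hlr : l < r) (q : Fin n → ℝ)
    {b : Fin (r - l - 1) → ℝ} (hb : ∀ j, b j = q ⟨l + j.1, by omega⟩) {s : ℕ}
    (hs : s ≤ r - l) :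
    pathOf (pathOf u v n q l) (pathOf u v n q r) (r - l - 1) b s =
      pathOf u v n q (l + s) := by
  rcases s with _ | i
  · simp [pathOf_zero]
  · by_cases hi : i < r - l - 1
    · rw [pathOf_add_one _ _ _ hi, hb, ← add_assoc, pathOf_add_one]
    · rw [pathOf_of_lt _ _ _ (by omega), show l + (i + 1) = r by omega]

/-- The event `{σ = l, τ = r}` for `l < t < r`: the path is below `h` at `l` and `r`, and
at least `h` strictly in between. -/
lemma sigmaTime_eq_and_tauTime_eq_iff {n l r t : ℕ} {h : ℝ} (hh : 0 < h) (hlt : l < t)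
    (htr : t < r) (hr : r ≤ n + 1) (q : Fin n → ℝ) :
    (sigmaTime 0 0 n h t q = l ∧ tauTime 0 0 n h t q = r) ↔
      pathOf 0 0 n q l < h ∧ pathOf 0 0 n q r < h ∧
        ∀ s, l < s → s < r → h ≤ pathOf 0 0 n q s := by
  classical
  have hne : {s | t ≤ s ∧ pathOf 0 0 n q s < h}.Nonempty :=
    ⟨n + 1, by omega, by rw [pathOf_of_lt _ _ _ (by omega)]; exact hh⟩
  unfold sigmaTime tauTime
  rw [Nat.findGreatest_eq_iff]
  constructor
  · rintro ⟨⟨-, h2, h3⟩, h4⟩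
    have h5 := Nat.sInf_mem hne
    rw [h4] at h5
    refine ⟨?_, h5.2, fun s hls hsr => ?_⟩
    · by_cases hl : l = 0
      · rw [hl, pathOf_zero]; exact hh
      · exact h2 hl
    · by_contra! hc
      rcases le_or_gt s t with hst | hst
      · exact h3 hls hst hc
      · have := Nat.sInf_le (show s ∈ {s | t ≤ s ∧ pathOf 0 0 n q s < h} from ⟨hst.le, hc⟩)
        omega
  · rintro ⟨h1, h2, h3⟩
    refine ⟨⟨hlt.le, fun _ => h1, fun s hls hst => not_lt.2 (h3 s hls (by omega))⟩, ?_⟩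
    refine le_antisymm (Nat.sInf_le ⟨htr.le, h2⟩) (le_csInf hne ?_)
    rintro s ⟨hts, hs⟩
    by_contra! hc
    exact absurd hs (not_lt.2 (h3 s (by omega) hc))

/-- If one of the times `σ`, `τ` equals `t`, then so does the other. -/
lemma sigmaTime_eq_iff_tauTime_eq {n t : ℕ} {h : ℝ} (hh : 0 < h) (ht : t ≤ n + 1)
    (q : Fin n → ℝ) : sigmaTime 0 0 n h t q = t ↔ tauTime 0 0 n h t q = t := by
  classical
  have hne : {s | t ≤ s ∧ pathOf 0 0 n q s < h}.Nonempty :=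
    ⟨n + 1, ht, by rw [pathOf_of_lt _ _ _ (by omega)]; exact hh⟩
  unfold sigmaTime tauTime
  rw [Nat.findGreatest_eq_iff]
  constructor
  · rintro ⟨-, h2, -⟩
    have h3 : pathOf 0 0 n q t < h := by
      by_cases h0 : t = 0
      · rw [h0, pathOf_zero]; exact hh
      · exact h2 h0
    exact le_antisymm (Nat.sInf_le ⟨le_rfl, h3⟩) (le_csInf hne fun s hs => hs.1)
  · intro h4
    have h5 := Nat.sInf_mem hne
    rw [h4] at h5
    exact ⟨le_rfl, fun _ => h5.2, fun s h6 h7 => absurd h6 (by omega)⟩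

open scoped Classical in
/-- The factor of the tilted density, restricted to `A ∩ {σ = l} ∩ {τ = r}`, which depends
only on the path outside `(l, r)`. -/
noncomputable def outerWeight (H : ℝ → ℝ) (n : ℕ) (c h : ℝ) (l r : ℕ) (A : Set (Fin n → ℝ))
    (q : Fin n → ℝ) : ℝ :=
  (∏ j ∈ Finset.range l, Real.exp (-(H (pathOf 0 0 n q (j + 1) - pathOf 0 0 n q j))))
    * (∏ j ∈ Finset.Ico r (n + 1),
        Real.exp (-(H (pathOf 0 0 n q (j + 1) - pathOf 0 0 n q j))))
    * Real.exp (-(c * ((∑ j ∈ Finset.range l, pathOf 0 0 n q j)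
        + (∑ j ∈ Finset.Ico r (n + 1), pathOf 0 0 n q j) + ((r - l : ℕ) : ℝ) * h)))
    * if q ∈ A ∧ pathOf 0 0 n q l < h ∧ pathOf 0 0 n q r < h ∧
        ∀ s, s ≤ l ∨ r ≤ s → 0 ≤ pathOf 0 0 n q s then 1 else 0

lemma measurable_outerWeight {H : ℝ → ℝ} (hH : Measurable H) (n : ℕ) (c h : ℝ) (l r : ℕ)
    {A : Set (Fin n → ℝ)} (hA : MeasurableSet A) : Measurable (outerWeight H n c h l r A) := by
  have hp : ∀ s, Measurable fun q : Fin n → ℝ => pathOf 0 0 n q s := fun s =>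
    (measurable_pathOf n s).comp
      (measurable_const.prodMk (measurable_const.prodMk measurable_id))
  unfold outerWeight
  refine Measurable.mul (by fun_prop) (Measurable.ite ?_ measurable_const measurable_const)
  simp only [Set.ofPred_and, Set.ofPred_forall, Set.ofPred_mem_eq]
  exact hA.inter ((measurableSet_lt (hp l) measurable_const).inter
    ((measurableSet_lt (hp r) measurable_const).inter
      (.iInter fun s => .iInter fun _ => measurableSet_le measurable_const (hp s))))

lemma outerWeight_congr (H : ℝ → ℝ) {n : ℕ} (c h : ℝ) {l r : ℕ}
    {A : Set (Fin n → ℝ)} {q q' : Fin n → ℝ} (hA : q ∈ A ↔ q' ∈ A)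
    (hq : ∀ s, s ≤ l ∨ r ≤ s → pathOf 0 0 n q s = pathOf 0 0 n q' s) :
    outerWeight H n c h l r A q = outerWeight H n c h l r A q' := by
  classical
  unfold outerWeight
  congr 1
  · congr 1
    · congr 1
      · refine Finset.prod_congr rfl fun j hj => ?_
        have := Finset.mem_range.1 hj
        rw [hq j (by omega), hq (j + 1) (by omega)]
      · refine Finset.prod_congr rfl fun j hj => ?_
        have := Finset.mem_Ico.1 hj
        rw [hq j (by omega), hq (j + 1) (by omega)]
    · rw [Finset.sum_congr rfl fun j hj => hq j (by have := Finset.mem_range.1 hj; omega),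
        Finset.sum_congr rfl fun j hj => hq j (by have := Finset.mem_Ico.1 hj; omega)]
  · refine if_congr ?_ rfl rfl
    rw [hA, hq l (.inl le_rfl), hq r (.inr le_rfl)]
    refine and_congr_right fun _ => and_congr_right fun _ => and_congr_right fun _ => ?_
    exact forall_congr' fun s => forall_congr' fun hs => by rw [hq s hs]

/-- Markov factorization of the tilted density on `A ∩ {σ = l} ∩ {τ = r}`. -/
lemma indicator_tiltedDensity_eq_mul (H : ℝ → ℝ) {n : ℕ} (c : ℝ) {h : ℝ} (hh : 0 < h)
    {l r : ℕ} (hlr : l < r) (hr : r ≤ n + 1) (A : Set (Fin n → ℝ)) (q : Fin n → ℝ)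
    {b : Fin (r - l - 1) → ℝ} (hb : ∀ j, b j = q ⟨l + j.1, by omega⟩) :
    (A ∩ {q | pathOf 0 0 n q l < h ∧ pathOf 0 0 n q r < h ∧
        ∀ s, l < s → s < r → h ≤ pathOf 0 0 n q s}).indicator
      (tiltedDensity H 0 0 n c fun _ => 0) q =
    outerWeight H n c h l r A q *
      tiltedDensity H (pathOf 0 0 n q l) (pathOf 0 0 n q r) (r - l - 1) c (fun _ => h) b := by
  classical
  have hw : ∀ s ≤ r - l, pathOf (pathOf 0 0 n q l) (pathOf 0 0 n q r) (r - l - 1) b s =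
      pathOf 0 0 n q (l + s) := fun s hs => pathOf_window 0 0 hr hlr q hb hs
  have hm : r - l - 1 + 1 = r - l := by omega
  have hprod : bridgeDensity H 0 0 n q =
      (∏ j ∈ Finset.range l, Real.exp (-(H (pathOf 0 0 n q (j + 1) - pathOf 0 0 n q j)))) *
      (∏ j ∈ Finset.Ico r (n + 1),
        Real.exp (-(H (pathOf 0 0 n q (j + 1) - pathOf 0 0 n q j)))) *
      bridgeDensity H (pathOf 0 0 n q l) (pathOf 0 0 n q r) (r - l - 1) b := by
    have h1 : bridgeDensity H (pathOf 0 0 n q l) (pathOf 0 0 n q r) (r - l - 1) b =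
        ∏ j ∈ Finset.Ico l r,
          Real.exp (-(H (pathOf 0 0 n q (j + 1) - pathOf 0 0 n q j))) := by
      rw [Finset.prod_Ico_eq_prod_range, bridgeDensity, hm]
      refine Finset.prod_congr rfl fun j hj => ?_
      have := Finset.mem_range.1 hj
      rw [hw j (by omega), hw (j + 1) (by omega), add_assoc]
    rw [h1, bridgeDensity, ← Finset.prod_range_mul_prod_Ico _ hr,
      ← Finset.prod_range_mul_prod_Ico _ hlr.le]
    ring
  have hsum : ∑ j ∈ Finset.range (n + 1), (pathOf 0 0 n q j - 0) =
      ((∑ j ∈ Finset.range l, pathOf 0 0 n q j)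
        + (∑ j ∈ Finset.Ico r (n + 1), pathOf 0 0 n q j) + ((r - l : ℕ) : ℝ) * h) +
      ∑ j ∈ Finset.range (r - l - 1 + 1),
        (pathOf (pathOf 0 0 n q l) (pathOf 0 0 n q r) (r - l - 1) b j - h) := by
    have h1 : ∑ j ∈ Finset.range (r - l - 1 + 1),
        (pathOf (pathOf 0 0 n q l) (pathOf 0 0 n q r) (r - l - 1) b j - h) =
        ∑ j ∈ Finset.Ico l r, pathOf 0 0 n q j - ((r - l : ℕ) : ℝ) * h := by
      rw [Finset.sum_sub_distrib, Finset.sum_Ico_eq_sum_range, hm]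
      simp only [Finset.sum_const, Finset.card_range, nsmul_eq_mul]
      congr 1
      refine Finset.sum_congr rfl fun j hj => hw j ?_
      have := Finset.mem_range.1 hj
      omega
    rw [h1]
    simp only [sub_zero]
    rw [← Finset.sum_range_add_sum_Ico _ hr, ← Finset.sum_range_add_sum_Ico _ hlr.le]
    ring
  have hin : (∀ t, 1 ≤ t → t ≤ r - l - 1 →
      h ≤ pathOf (pathOf 0 0 n q l) (pathOf 0 0 n q r) (r - l - 1) b t) ↔
      ∀ s, l < s → s < r → h ≤ pathOf 0 0 n q s := by
    constructor
    · intro H1 s hls hsr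
      have := H1 (s - l) (by omega) (by omega)
      rwa [hw _ (by omega), show l + (s - l) = s by omega] at this
    · intro H1 s hs1 hs2
      rw [hw s (by omega)]
      exact H1 _ (by omega) (by omega)
  have hpos : ∀ hmid : ∀ s, l < s → s < r → h ≤ pathOf 0 0 n q s,
      ((∀ t, 1 ≤ t → t ≤ n → 0 ≤ pathOf 0 0 n q t) ↔
        ∀ s, s ≤ l ∨ r ≤ s → 0 ≤ pathOf 0 0 n q s) := by
    intro hmid
    constructor
    · intro H1 s _
      by_cases hs : 1 ≤ s ∧ s ≤ n
      · exact H1 s hs.1 hs.2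
      · rcases Nat.eq_zero_or_pos s with h0 | h0
        · rw [h0, pathOf_zero]
        · rw [pathOf_of_lt _ _ _ (by omega)]
    · intro H1 s _ _
      by_cases hs : s ≤ l ∨ r ≤ s
      · exact H1 s hs
      · exact hh.le.trans (hmid s (by omega) (by omega))
  simp only [Set.indicator_apply, Set.mem_inter_iff, Set.mem_ofPred_eq, tiltedDensity,
    outerWeight, hprod, hsum, hin, mul_add, neg_add, Real.exp_add]
  generalize (∀ s, l < s → s < r → h ≤ pathOf 0 0 n q s) = mid at hpos ⊢
  generalize (∀ t, 1 ≤ t → t ≤ n → 0 ≤ pathOf 0 0 n q t) = nonneg at hpos ⊢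
  generalize (∀ s, s ≤ l ∨ r ≤ s → 0 ≤ pathOf 0 0 n q s) = nonnegOut at hpos ⊢
  by_cases hmid : mid
  · rw [if_congr (hpos hmid) rfl rfl]
    by_cases h1 : q ∈ A <;> by_cases h2 : pathOf 0 0 n q l < h <;>
      by_cases h3 : pathOf 0 0 n q r < h <;> by_cases h4 : nonnegOut <;>
      simp only [h1, h2, h3, h4, hmid, and_self, and_false, false_and, if_true,
        if_false, mul_one, mul_zero, zero_mul]
    ring
  · simp only [hmid, and_false, if_false, mul_zero]

lemma setIntegral_normalizeMeasure_withDensity {α : Type*} [MeasurableSpace α] (μ : Measure α)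
    {w : α → ℝ} (hw : Measurable w) (hw0 : ∀ x, 0 ≤ w x) {E : Set α} (hE : MeasurableSet E)
    (φ : α → ℝ) :
    ∫ x in E, φ x ∂(normalizeMeasure (μ.withDensity fun x => ENNReal.ofReal (w x))) =
      (((μ.withDensity fun x => ENNReal.ofReal (w x)) Set.univ)⁻¹).toReal *
        ∫ x, E.indicator w x * φ x ∂μ := by
  rw [normalizeMeasure, Measure.restrict_smul, integral_smul_measure, smul_eq_mul,
    setIntegral_withDensity_eq_setIntegral_toReal_smul hw.ennreal_ofReal (by simp) _ hE,
    ← integral_indicator hE]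
  congr 2 with x
  by_cases hx : x ∈ E <;> simp [hx, ENNReal.toReal_ofReal (hw0 x)]

lemma isProbabilityMeasure_normalizeMeasure {α : Type*} [MeasurableSpace α] {μ : Measure α}
    (h0 : μ Set.univ ≠ 0) (hfin : μ Set.univ ≠ ⊤) :
    IsProbabilityMeasure (normalizeMeasure μ) :=
  ⟨by simp [normalizeMeasure, ENNReal.inv_mul_cancel h0 hfin]⟩

lemma tiltedMeasure_zero_univ (H : ℝ → ℝ) (u v c : ℝ) (floor : ℕ → ℝ) :
    tiltedMeasure H u v 0 c floor Set.univ ≠ 0 ∧ tiltedMeasure H u v 0 c floor Set.univ ≠ ⊤ := by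
  have hpos : ∀ q, 0 < tiltedDensity H u v 0 c floor q := by
    intro q
    unfold tiltedDensity bridgeDensity
    rw [if_pos (fun t h1 h2 => absurd h1 (by omega))]
    positivity
  rw [tiltedMeasure_eq_withDensity, withDensity_apply _ MeasurableSet.univ,
    Measure.restrict_univ, Measure.volume_pi_eq_dirac (x := fun i => i.elim0), lintegral_dirac]
  exact ⟨by simpa using hpos _, ENNReal.ofReal_ne_top⟩

/-- Strong Gibbs decomposition over the excursion interval: let `X` be a
`λ`-area-tilted random walk bridge on `⟦0,n+1⟧` with floor `0` and zero boundary
values, `R > 0`, `t ∈ I`. With `σ` the last time `≤ t` and `τ` the first time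
`≥ t` at which `X < (R/2)H_λ` and `J = ⟦σ,τ⟧`, conditionally on the σ-algebra
`𝓕_{σ,τ}` (here expressed through its generating events
`A ∩ {σ = ℓ} ∩ {τ = r}` with `A` depending only on the path outside `(ℓ,r)`),
the restriction `X|_J` is a `λ`-tilted bridge on `J` with boundary values
`X(σ), X(τ)` and floor `(R/2)H_λ` in the interior of `J`: for every bounded
measurable functional `F` the conditional expectation identity holds in
integrated form. -/
theorem strong_gibbs_excursion (H : ℝ → ℝ) (hH : RWAssumptions H)
    (N : ℕ) (hN : 1 ≤ N) (lam : ℝ) (hlam : 0 < lam) (hlamN : lam < N)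
    (R : ℝ) (hR : 0 < R) (n : ℕ) (t : ℕ) (ht : t ≤ n + 1)
    (hpos : 0 < tiltedMeasure H 0 0 n (lam / N) (fun _ => 0) Set.univ)
    (hfin : tiltedMeasure H 0 0 n (lam / N) (fun _ => 0) Set.univ < ⊤)
    (F : (ℕ → ℝ) → ℕ → ℕ → ℝ)
    (hFmeas : ∀ l r : ℕ, Measurable fun X : ℕ → ℝ => F X l r)
    (hFbdd : ∃ Cb : ℝ, ∀ X l r, |F X l r| ≤ Cb) :
    ∀ l r : ℕ, l ≤ t → t ≤ r → r ≤ n + 1 →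
    ∀ A : Set (Fin n → ℝ), MeasurableSet A →
    (∀ q q' : Fin n → ℝ,
        (∀ s : ℕ, s ≤ l ∨ r ≤ s → pathOf 0 0 n q s = pathOf 0 0 n q' s) →
        (q ∈ A ↔ q' ∈ A)) →
    (∫ q in A ∩ {q | sigmaTime 0 0 n (R / 2 * Hlam lam N) t q = l}
            ∩ {q | tauTime 0 0 n (R / 2 * Hlam lam N) t q = r},
        F (restrictPath (pathOf 0 0 n q) l r) l r
        ∂(normalizeMeasure (tiltedMeasure H 0 0 n (lam / N) (fun _ => 0))))
      = ∫ q in A ∩ {q | sigmaTime 0 0 n (R / 2 * Hlam lam N) t q = l}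
            ∩ {q | tauTime 0 0 n (R / 2 * Hlam lam N) t q = r},
          (∫ q',
            F (restrictPath
                (fun s => pathOf (pathOf 0 0 n q l) (pathOf 0 0 n q r)
                  (r - l - 1) q' (s - l)) l r) l r
            ∂(normalizeMeasure (tiltedMeasure H (pathOf 0 0 n q l)
                (pathOf 0 0 n q r) (r - l - 1) (lam / N)
                (fun _ => R / 2 * Hlam lam N))))
          ∂(normalizeMeasure (tiltedMeasure H 0 0 n (lam / N) (fun _ => 0))) := by
  intro l r hlt htr hrn A hA hAout
  set c : ℝ := lam / N
  have hh : 0 < R / 2 * Hlam lam N := by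
    have hN0 : (0 : ℝ) < N := by exact_mod_cast hN
    rw [Hlam]
    positivity
  generalize R / 2 * Hlam lam N = h at hh ⊢
  rcases (hlt.trans htr).eq_or_lt with hlr | hlr
  · obtain rfl : l = t := by omega
    subst hlr
    congr 1
    funext q
    rw [Nat.sub_self, Nat.zero_sub]
    have hprob := isProbabilityMeasure_normalizeMeasure
      (tiltedMeasure_zero_univ H (pathOf 0 0 n q l) (pathOf 0 0 n q l) c fun _ => h).1
      (tiltedMeasure_zero_univ H (pathOf 0 0 n q l) (pathOf 0 0 n q l) c fun _ => h).2
    have hconst : ∀ q' : Fin 0 → ℝ,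
        restrictPath (fun s => pathOf (pathOf 0 0 n q l) (pathOf 0 0 n q l) 0 q' (s - l)) l l =
          restrictPath (pathOf 0 0 n q) l l := by
      intro q'
      funext s
      unfold restrictPath
      split_ifs with hs
      · obtain rfl : s = l := by omega
        simp only [Nat.sub_self, pathOf_zero]
      · rfl
    simp only [hconst, integral_const, probReal_univ, one_smul]
  by_cases hstrict : l < t ∧ t < r
  swap
  · have hempty : A ∩ {q | sigmaTime 0 0 n h t q = l} ∩ {q | tauTime 0 0 n h t q = r} = ∅ := by
      rw [Set.eq_empty_iff_forall_notMem]
      rintro q ⟨⟨-, h1⟩, h2⟩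
      have h3 := sigmaTime_eq_iff_tauTime_eq hh ht q
      simp only [Set.mem_ofPred_eq] at h1 h2
      rw [h1, h2] at h3
      omega
    simp [hempty]
  obtain ⟨hlt, htr⟩ := hstrict
  obtain ⟨Cb, hCb⟩ := hFbdd
  have hHm : Measurable H :=
    (continuousOn_univ.1 (hH.convex.continuousOn isOpen_univ)).measurable
  have hp : ∀ s, Measurable fun q : Fin n → ℝ => pathOf 0 0 n q s := fun s =>
    (measurable_pathOf n s).comp
      (measurable_const.prodMk (measurable_const.prodMk measurable_id))
  have hEeq : A ∩ {q | sigmaTime 0 0 n h t q = l} ∩ {q | tauTime 0 0 n h t q = r} =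
      A ∩ {q | pathOf 0 0 n q l < h ∧ pathOf 0 0 n q r < h ∧
        ∀ s, l < s → s < r → h ≤ pathOf 0 0 n q s} := by
    ext q
    rw [Set.inter_assoc]
    exact and_congr_right fun _ => sigmaTime_eq_and_tauTime_eq_iff hh hlt htr hrn q
  rw [hEeq]
  set E := A ∩ {q | pathOf 0 0 n q l < h ∧ pathOf 0 0 n q r < h ∧
        ∀ s, l < s → s < r → h ≤ pathOf 0 0 n q s} with hE_def
  have hE : MeasurableSet E := by
    simp only [hE_def, Set.ofPred_and, Set.ofPred_forall]
    exact hA.inter ((measurableSet_lt (hp l) measurable_const).inter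
      ((measurableSet_lt (hp r) measurable_const).inter
        (.iInter fun s => .iInter fun _ => .iInter fun _ =>
          measurableSet_le measurable_const (hp s))))
  have hpair : Measurable fun q : Fin n → ℝ => ((0 : ℝ), (0 : ℝ), q) :=
    measurable_const.prodMk (measurable_const.prodMk measurable_id)
  have hw_comp := (measurable_tiltedDensity hHm n c fun _ => 0).comp hpair
  have hwm : Measurable (tiltedDensity H 0 0 n c fun _ => 0) := hw_comp
  have hw0 := tiltedDensity_nonneg H 0 0 n c fun _ => 0
  rw [tiltedMeasure_eq_withDensity H 0 0 n c] at hfin ⊢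
  rw [setIntegral_normalizeMeasure_withDensity _ hwm hw0 hE,
    setIntegral_normalizeMeasure_withDensity _ hwm hw0 hE]
  refine congrArg (HMul.hMul _) ?_
  obtain ⟨e, he, he1, he2⟩ := exists_measurableEquiv_window hrn hlr
  let base : ({i : Fin n // i.1 + 1 ≤ l ∨ r ≤ i.1 + 1} → ℝ) → Fin n → ℝ :=
    fun a => e.symm (a, 0)
  have hbase : Measurable base := e.symm.measurable.comp measurable_prodMk_right
  have hpath : ∀ q s, (s ≤ l ∨ r ≤ s) →
      pathOf 0 0 n q s = pathOf 0 0 n (base (e q).1) s := by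
    intro q
    have hq : ∀ i : Fin n, (i.1 + 1 ≤ l ∨ r ≤ i.1 + 1) → q i = base (e q).1 i := by
      intro i hi
      rw [← he1 q ⟨i, hi⟩, ← he1 (base (e q).1) ⟨i, hi⟩, MeasurableEquiv.apply_symm_apply]
    exact pathOf_congr_outside 0 0 hq
  let U := fun a => pathOf 0 0 n (base a) l
  let V := fun a => pathOf 0 0 n (base a) r
  have hU : Measurable U := (hp l).comp hbase
  have hV : Measurable V := (hp r).comp hbase
  have hpl : ∀ q, pathOf 0 0 n q l = U (e q).1 := fun q => hpath q l (.inl le_rfl)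
  have hpr : ∀ q, pathOf 0 0 n q r = V (e q).1 := fun q => hpath q r (.inr le_rfl)
  let g := fun a => outerWeight H n c h l r A (base a)
  let k := fun p : ({i : Fin n // i.1 + 1 ≤ l ∨ r ≤ i.1 + 1} → ℝ) × (Fin (r - l - 1) → ℝ) =>
    tiltedDensity H (U p.1) (V p.1) (r - l - 1) c (fun _ => h) p.2
  let f := fun p : ({i : Fin n // i.1 + 1 ≤ l ∨ r ≤ i.1 + 1} → ℝ) × (Fin (r - l - 1) → ℝ) =>
    F (restrictPath (fun s => pathOf (U p.1) (V p.1) (r - l - 1) p.2 (s - l)) l r) l r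
  have hUV : Measurable fun p : ({i : Fin n // i.1 + 1 ≤ l ∨ r ≤ i.1 + 1} → ℝ) ×
      (Fin (r - l - 1) → ℝ) => (U p.1, V p.1, p.2) :=
    (hU.comp measurable_fst).prodMk ((hV.comp measurable_fst).prodMk measurable_snd)
  have hg : Measurable g := (measurable_outerWeight hHm n c h l r hA).comp hbase
  have hk_comp := (measurable_tiltedDensity hHm (r - l - 1) c fun _ => h).comp hUV
  have hk : Measurable k := hk_comp
  have hf : Measurable f := by
    have hpi : Measurable fun p : ({i : Fin n // i.1 + 1 ≤ l ∨ r ≤ i.1 + 1} → ℝ) ×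
        (Fin (r - l - 1) → ℝ) =>
        restrictPath (fun s => pathOf (U p.1) (V p.1) (r - l - 1) p.2 (s - l)) l r := by
      rw [measurable_pi_iff]
      intro s
      unfold restrictPath
      split_ifs
      · exact (measurable_pathOf _ _).comp hUV
      · exact measurable_const
    exact (hFmeas l r).comp hpi
  have hgk : ∀ q, E.indicator (tiltedDensity H 0 0 n c fun _ => 0) q =
      g (e q).1 * k (e q) := by
    intro q
    rw [hE_def, indicator_tiltedDensity_eq_mul H c hh hlr hrn A q (he2 q), hpl, hpr,
      outerWeight_congr H c h (hAout q _ (hpath q)) (hpath q)]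
  have hfq : ∀ q, F (restrictPath (pathOf 0 0 n q) l r) l r = f (e q) := by
    intro q
    simp only [f]
    congr 1
    funext s
    unfold restrictPath
    split_ifs with hs
    · have hwin := pathOf_window 0 0 hrn hlr q (he2 q) (show s - l ≤ r - l by omega)
      rw [show l + (s - l) = s by omega] at hwin
      simp only [← hpl, ← hpr, hwin]
    · rfl
  have hint : Integrable (fun p => g p.1 * k p) (volume.prod volume) := by
    rw [← he.integrable_comp_emb e.measurableEmbedding]
    have h1 : Integrable (tiltedDensity H 0 0 n c fun _ => 0) := by
      refine ⟨hwm.aestronglyMeasurable, ?_⟩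
      rw [hasFiniteIntegral_iff_ofReal (.of_forall hw0)]
      simpa [withDensity_apply _ MeasurableSet.univ] using hfin
    exact (h1.indicator hE).congr (.of_forall hgk)
  have hmain := integral_mul_eq_integral_mul_normalizeMeasure volume volume
    (fun p => tiltedDensity_nonneg _ _ _ _ _ _ _) hk hf (fun p => hCb _ l r) hint
  rw [← he.integral_comp', ← he.integral_comp'] at hmain
  simp only [hgk, hfq, hpl, hpr, tiltedMeasure_eq_withDensity]
  exact hmain
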